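/- arXiv:1405.0084 — 5 statements merged into one kernel-verified Lean document; each statement's English description precedes it below -/
import Mathlib

section
/- For every x ∈ ℝ^n, φ_t(x) converges, as t → ∞, to the relative (max,+)-function φ(x) = max_{1≤k≤m}(α_k + a_k·x) − max_{1≤j≤l}(β_j + b_j·x). -/
open Finset

/-- `log_t u = ln u / ln t`. -/
noncomputable def logb' (t u : ℝ) : ℝ := Real.log u / Real.log t

/-- The relative `R_t`-polynomial
`φ_t(x) = log_t (Σ_k t^(α_k + a_k·x)) − log_t (Σ_j t^(β_j + b_j·x))`. -/
noncomputable def relRtPoly (n m l : ℕ) (α : Fin m → ℝ) (β : Fin l → ℝ)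
    (a : Fin m → Fin n → ℤ) (b : Fin l → Fin n → ℤ) (t : ℝ) (x : Fin n → ℝ) : ℝ :=
  logb' t (∑ k, t ^ (α k + ∑ i, (a k i : ℝ) * x i))
    - logb' t (∑ j, t ^ (β j + ∑ i, (b j i : ℝ) * x i))

/-- The logarithm in base `t` of a finite sum of powers of `t` tends to the largest exponent. -/
theorem tendsto_logb'_sum_rpow {ι : Type*} (s : Finset ι) (hs : s.Nonempty) (c : ι → ℝ) :
    Filter.Tendsto (fun t : ℝ => logb' t (∑ k ∈ s, t ^ c k)) Filter.atTop
      (nhds (s.sup' hs c)) := by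
  have hupper : Filter.Tendsto (fun t : ℝ => Real.log s.card / Real.log t + s.sup' hs c)
      Filter.atTop (nhds (s.sup' hs c)) := by
    simpa using (Real.tendsto_log_atTop.const_div_atTop (Real.log s.card)).add_const (s.sup' hs c)
  refine tendsto_of_tendsto_of_tendsto_of_le_of_le' tendsto_const_nhds hupper ?_ ?_
  · filter_upwards [Filter.eventually_gt_atTop 1] with t ht
    have ht0 : 0 < t := by linarith
    obtain ⟨k, hk, hmax⟩ := s.exists_mem_eq_sup' hs c
    rw [hmax, logb', le_div_iff₀ (Real.log_pos ht), ← Real.log_rpow ht0]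
    exact Real.log_le_log (Real.rpow_pos_of_pos ht0 _)
      (Finset.single_le_sum (f := fun k => t ^ c k)
        (fun i _ => (Real.rpow_pos_of_pos ht0 _).le) hk)
  · filter_upwards [Filter.eventually_gt_atTop 1] with t ht
    have ht0 : 0 < t := by linarith
    have hlog := Real.log_pos ht
    have hcard : (s.card : ℝ) ≠ 0 := by exact_mod_cast hs.card_pos.ne'
    have hsum : ∑ k ∈ s, t ^ c k ≤ s.card * t ^ s.sup' hs c := by
      rw [← nsmul_eq_mul]
      exact Finset.sum_le_card_nsmul _ _ _ fun k hk =>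
        Real.rpow_le_rpow_of_exponent_le ht.le (Finset.le_sup' c hk)
    rw [logb', div_le_iff₀ hlog, add_mul, div_mul_cancel₀ _ hlog.ne', ← Real.log_rpow ht0,
      ← Real.log_mul hcard (Real.rpow_pos_of_pos ht0 _).ne']
    exact Real.log_le_log
      (Finset.sum_pos (fun k _ => Real.rpow_pos_of_pos ht0 _) hs) hsum

/-- As `t → ∞`, the relative `R_t`-polynomial `φ_t(x)` converges to the relative
`(max,+)`-function `φ(x) = max_k (α_k + a_k·x) − max_j (β_j + b_j·x)`. -/
theorem relRtPoly_tendsto_maxPlus (n m l : ℕ) (hn : 1 ≤ n) (hm : 1 ≤ m) (hl : 1 ≤ l)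
    (α : Fin m → ℝ) (β : Fin l → ℝ) (a : Fin m → Fin n → ℤ) (b : Fin l → Fin n → ℤ)
    (x : Fin n → ℝ) :
    Filter.Tendsto (fun t : ℝ => relRtPoly n m l α β a b t x) Filter.atTop
      (nhds ((Finset.univ.sup' ⟨⟨0, hm⟩, Finset.mem_univ _⟩
                (fun k => α k + ∑ i, (a k i : ℝ) * x i))
        - Finset.univ.sup' ⟨⟨0, hl⟩, Finset.mem_univ _⟩
                (fun j => β j + ∑ i, (b j i : ℝ) * x i))) := by
  exact (tendsto_logb'_sum_rpow Finset.univ _ _).sub (tendsto_logb'_sum_rpow Finset.univ _ _)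
end

section
/- For every t > 1, every (x, y) ∈ (ZMod n → ℝ)², and every integer l ≥ 0, the sup distance between φ^l(x, y) and φ_t^l(x, y) is at most ((5^l − 1)/4) · log_t 4. -/
/-- The pentagram automaton on pairs of real tuples indexed by `ZMod n`. -/
noncomputable def pentagramAutomaton (n : ℕ) (p : (ZMod n → ℝ) × (ZMod n → ℝ)) :
    (ZMod n → ℝ) × (ZMod n → ℝ) :=
  (fun i => p.1 i + max 0 (p.1 (i - 1) + p.2 (i - 1)) - max 0 (p.1 (i + 1) + p.2 (i + 1)),
   fun i => p.2 (i + 1) + max 0 (p.1 (i + 2) + p.2 (i + 2)) - max 0 (p.1 i + p.2 i))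

/-- The intermediate tropicalization `φ_t` of the pentagram map. -/
noncomputable def pentagramRt (n : ℕ) (t : ℝ) (p : (ZMod n → ℝ) × (ZMod n → ℝ)) :
    (ZMod n → ℝ) × (ZMod n → ℝ) :=
  (fun i => p.1 i + logb' t (1 + t ^ (p.1 (i - 1) + p.2 (i - 1)))
      - logb' t (1 + t ^ (p.1 (i + 1) + p.2 (i + 1))),
   fun i => p.2 (i + 1) + logb' t (1 + t ^ (p.1 (i + 2) + p.2 (i + 2)))
      - logb' t (1 + t ^ (p.1 i + p.2 i)))

/-- Replacing `max 0 a` by `log_t (1 + t ^ a)` costs at most `log_t 2`. -/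
theorem logb'_one_add_rpow_sub_max_mem_Icc {t : ℝ} (ht : 1 < t) (a : ℝ) :
    logb' t (1 + t ^ a) - max 0 a ∈ Set.Icc 0 (logb' t 2) := by
  have ht0 : 0 < t := by linarith
  have hlog : 0 < Real.log t := Real.log_pos ht
  have hpow : 0 < t ^ a := Real.rpow_pos_of_pos ht0 a
  have hmax : max 0 a * Real.log t = Real.log (t ^ max 0 a) := (Real.log_rpow ht0 _).symm
  have h0 : 1 ≤ t ^ max 0 a := Real.one_le_rpow ht.le (le_max_left _ _)
  have ha : t ^ a ≤ t ^ max 0 a := Real.rpow_le_rpow_of_exponent_le ht.le (le_max_right _ _)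
  have hle : t ^ max 0 a ≤ 1 + t ^ a := by
    rcases max_choice 0 a with h | h <;> rw [h]
    · rw [Real.rpow_zero]
      linarith
    · linarith
  unfold logb'
  constructor
  · rw [sub_nonneg, le_div_iff₀ hlog, hmax]
    exact Real.log_le_log (by linarith) hle
  · have : Real.log (1 + t ^ a) ≤ Real.log 2 + max 0 a * Real.log t := by
      rw [hmax, ← Real.log_mul two_ne_zero (by linarith)]
      exact Real.log_le_log (by linarith) (by linarith)
    have h := div_le_div_of_nonneg_right this hlog.le
    rw [add_div, mul_div_cancel_right₀ _ hlog.ne'] at h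
    linarith

/-- One step of the automaton and one step of `φ_t` move points at distance `d` to points at
distance at most `5 d + log_t 2`. -/
theorem dist_pentagramAutomaton_pentagramRt_le (n : ℕ) [NeZero n] {t : ℝ} (ht : 1 < t)
    (p q : (ZMod n → ℝ) × (ZMod n → ℝ)) :
    dist (pentagramAutomaton n p) (pentagramRt n t q) ≤ 5 * dist p q + logb' t 2 := by
  have hfst (i : ZMod n) : |p.1 i - q.1 i| ≤ dist p q :=
    (dist_le_pi_dist p.1 q.1 i).trans (le_max_left _ _)
  have hsnd (i : ZMod n) : |p.2 i - q.2 i| ≤ dist p q :=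
    (dist_le_pi_dist p.2 q.2 i).trans (le_max_right _ _)
  have hmax (i : ZMod n) :
      |max 0 (p.1 i + p.2 i) - max 0 (q.1 i + q.2 i)| ≤ 2 * dist p q := by
    refine (abs_max_sub_max_le_max _ _ _ _).trans (max_le ?_ ?_)
    · rw [sub_self, abs_zero]
      positivity
    · rw [add_sub_add_comm]
      linarith [abs_add_le (p.1 i - q.1 i) (p.2 i - q.2 i), hfst i, hsnd i]
  have herr (i : ZMod n) := logb'_one_add_rpow_sub_max_mem_Icc ht (q.1 i + q.2 i)
  have hbound : 0 ≤ 5 * dist p q + logb' t 2 := by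
    linarith [(herr 0).1.trans (herr 0).2, dist_nonneg (x := p) (y := q)]
  refine max_le ((dist_pi_le_iff hbound).2 fun i => ?_) ((dist_pi_le_iff hbound).2 fun i => ?_)
  · have h₀ := abs_le.1 (hfst i)
    have h₁ := abs_le.1 (hmax (i - 1))
    have h₂ := abs_le.1 (hmax (i + 1))
    have e₁ := herr (i - 1)
    have e₂ := herr (i + 1)
    rw [Real.dist_eq, abs_le]
    simp only [pentagramAutomaton, pentagramRt]
    constructor <;> linarith [e₁.1, e₁.2, e₂.1, e₂.2]
  · have h₀ := abs_le.1 (hsnd (i + 1))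
    have h₁ := abs_le.1 (hmax (i + 2))
    have h₂ := abs_le.1 (hmax i)
    have e₁ := herr (i + 2)
    have e₂ := herr i
    rw [Real.dist_eq, abs_le]
    simp only [pentagramAutomaton, pentagramRt]
    constructor <;> linarith [e₁.1, e₁.2, e₂.1, e₂.2]

/-- For `t > 1`, the sup distance between the `l`-th iterates of `φ` and of `φ_t` at any
point is at most `((5^l − 1)/4) · log_t 4`. -/
theorem dist_pentagramAutomaton_pentagramRt_iterate_le (n : ℕ) [NeZero n]
    (t : ℝ) (ht : 1 < t) (p : (ZMod n → ℝ) × (ZMod n → ℝ)) (l : ℕ) :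
    dist ((pentagramAutomaton n)^[l] p) ((pentagramRt n t)^[l] p)
      ≤ (((5 : ℝ) ^ l - 1) / 4) * logb' t 4 := by
  have hlog : logb' t 2 ≤ logb' t 4 :=
    div_le_div_of_nonneg_right (Real.log_le_log (by norm_num) (by norm_num)) (Real.log_pos ht).le
  induction l with
  | zero => simp
  | succ l ih =>
    rw [Function.iterate_succ_apply', Function.iterate_succ_apply']
    calc _ ≤ 5 * dist ((pentagramAutomaton n)^[l] p) ((pentagramRt n t)^[l] p) + logb' t 2 :=
          dist_pentagramAutomaton_pentagramRt_le n ht _ _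
      _ ≤ 5 * ((((5 : ℝ) ^ l - 1) / 4) * logb' t 4) + logb' t 4 := by gcongr
      _ = (((5 : ℝ) ^ (l + 1) - 1) / 4) * logb' t 4 := by ring
end

section
/- Let n, k ≥ 1 and let (x, y) ∈ (ZMod n → ℝ)² be a k-periodic point of the pentagram automaton, i.e. φ^k(x, y) = (x, y). Let t > 1, set z_i = t^{x_i} and w_i = t^{y_i}, and write F^k(z, w) = (z^k, w^k). Then for every i ∈ ZMod n, each of the four ratios z_i/z^k_i, z^k_i/z_i, w_i/w^k_i, w^k_i/w_i is positive and at most 4^{(5^k − 1)/4}. -/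
/-- The rational map `F`, conjugate to the pentagram map in canonical coordinates. -/
noncomputable def Fmap (n : ℕ) (p : (ZMod n → ℝ) × (ZMod n → ℝ)) :
    (ZMod n → ℝ) × (ZMod n → ℝ) :=
  (fun i => p.1 i * (1 + p.1 (i - 1) * p.2 (i - 1)) / (1 + p.1 (i + 1) * p.2 (i + 1)),
   fun i => p.2 (i + 1) * (1 + p.1 (i + 2) * p.2 (i + 2)) / (1 + p.1 i * p.2 i))

/-- `log (1 + u * v)` agrees with `max 0 (a + b)` up to `2 * e + log 2`, when `a`, `b` approximate
`log u`, `log v` up to `e`. -/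
theorem log_one_add_mul_mem_Icc {u v a b e : ℝ} (hu : 0 < u) (hv : 0 < v)
    (ha : |Real.log u - a| ≤ e) (hb : |Real.log v - b| ≤ e) :
    Real.log (1 + u * v) ∈ Set.Icc
      (max 0 (a + b) - 2 * e) (max 0 (a + b) + 2 * e + Real.log 2) := by
  have huv : 0 < u * v := mul_pos hu hv
  have hl : Real.log (u * v) = Real.log u + Real.log v := Real.log_mul hu.ne' hv.ne'
  rw [abs_le] at ha hb
  have h1 : 0 ≤ Real.log (1 + u * v) := Real.log_nonneg (by linarith)
  have h2 : Real.log (u * v) ≤ Real.log (1 + u * v) := Real.log_le_log huv (by linarith)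
  have hm1 := le_max_left 0 (a + b)
  have hm2 := le_max_right 0 (a + b)
  constructor
  · rcases max_cases 0 (a + b) with h | h <;> rw [h.1] <;> linarith
  · rcases le_total (u * v) 1 with h | h
    · have : Real.log (1 + u * v) ≤ Real.log 2 := Real.log_le_log (by linarith) (by linarith)
      linarith
    · have : Real.log (1 + u * v) ≤ Real.log (2 * (u * v)) :=
        Real.log_le_log (by linarith) (by linarith)
      rw [Real.log_mul two_ne_zero huv.ne'] at this
      linarith

/-- If the logarithms of the inputs are approximated up to `e`, then the logarithm of the common
shape of both coordinates of `Fmap` is approximated by the corresponding coordinate of the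
automaton up to `5 * e + log 2`. -/
theorem abs_log_mul_div_sub_le {r a u v p q u' v' p' q' c e : ℝ} (hc : 0 ≤ c)
    (hr : 0 < r) (hu : 0 < u) (hv : 0 < v) (hu' : 0 < u') (hv' : 0 < v')
    (har : |Real.log r - c * a| ≤ e)
    (hp : |Real.log u - c * p| ≤ e) (hq : |Real.log v - c * q| ≤ e)
    (hp' : |Real.log u' - c * p'| ≤ e) (hq' : |Real.log v' - c * q'| ≤ e) :
    0 < r * (1 + u * v) / (1 + u' * v') ∧
    |Real.log (r * (1 + u * v) / (1 + u' * v')) -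
      c * (a + max 0 (p + q) - max 0 (p' + q'))| ≤ 5 * e + Real.log 2 := by
  refine ⟨by positivity, ?_⟩
  have h1 := log_one_add_mul_mem_Icc hu hv hp hq
  have h2 := log_one_add_mul_mem_Icc hu' hv' hp' hq'
  have hm (s : ℝ) : max 0 (c * s) = c * max 0 s := by
    rw [mul_max_of_nonneg _ _ hc, mul_zero]
  rw [← mul_add, hm, Set.mem_Icc] at h1 h2
  rw [Real.log_div (by positivity) (by positivity), Real.log_mul (by positivity) (by positivity)]
  rw [abs_le] at har ⊢
  constructor <;> linarith

/-- `Fmap` and the automaton stay close to each other in logarithmic coordinates. -/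
theorem Fmap_iterate_log_sub_pentagramAutomaton_iterate (n : ℕ) {c : ℝ} (hc : 0 ≤ c)
    (p q : (ZMod n → ℝ) × (ZMod n → ℝ)) (hp : ∀ i, 0 < p.1 i ∧ 0 < p.2 i)
    (hpq : ∀ i, Real.log (p.1 i) = c * q.1 i ∧ Real.log (p.2 i) = c * q.2 i) (k : ℕ) (i : ZMod n) :
    (0 < ((Fmap n)^[k] p).1 i ∧ |Real.log (((Fmap n)^[k] p).1 i) -
      c * ((pentagramAutomaton n)^[k] q).1 i| ≤ (5 ^ k - 1) / 4 * Real.log 2) ∧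
    (0 < ((Fmap n)^[k] p).2 i ∧ |Real.log (((Fmap n)^[k] p).2 i) -
      c * ((pentagramAutomaton n)^[k] q).2 i| ≤ (5 ^ k - 1) / 4 * Real.log 2) := by
  induction k generalizing i with
  | zero => simp [hp i, hpq i]
  | succ k ih =>
    have he : ((5 : ℝ) ^ (k + 1) - 1) / 4 * Real.log 2 =
        5 * ((5 ^ k - 1) / 4 * Real.log 2) + Real.log 2 := by ring
    rw [Function.iterate_succ_apply', Function.iterate_succ_apply', he]
    have hz j := (ih j).1
    have hw j := (ih j).2
    exact ⟨abs_log_mul_div_sub_le hc (hz i).1 (hz _).1 (hw _).1 (hz _).1 (hw _).1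
        (hz i).2 (hz _).2 (hw _).2 (hz _).2 (hw _).2,
      abs_log_mul_div_sub_le hc (hw (i + 1)).1 (hz _).1 (hw _).1 (hz _).1 (hw _).1
        (hw (i + 1)).2 (hz _).2 (hw _).2 (hz _).2 (hw _).2⟩

/-- A bound on the difference of logarithms bounds both ratios. -/
theorem div_le_rpow_of_abs_log_sub_le {a b B r : ℝ} (ha : 0 < a) (hb : 0 < b) (hB : 0 < B)
    (h : |Real.log b - Real.log a| ≤ r * Real.log B) :
    (0 < a / b ∧ a / b ≤ B ^ r) ∧ (0 < b / a ∧ b / a ≤ B ^ r) := by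
  rw [abs_le] at h
  have hBr : 0 < B ^ r := Real.rpow_pos_of_pos hB r
  refine ⟨⟨div_pos ha hb, ?_⟩, ⟨div_pos hb ha, ?_⟩⟩
  · rw [← Real.log_le_log_iff (div_pos ha hb) hBr, Real.log_rpow hB, Real.log_div ha.ne' hb.ne']
    linarith
  · rw [← Real.log_le_log_iff (div_pos hb ha) hBr, Real.log_rpow hB, Real.log_div hb.ne' ha.ne']
    linarith

/-- If `(x, y)` is a `k`-periodic point of the pentagram automaton, `t > 1`,
`z_i = t^(x_i)`, `w_i = t^(y_i)` and `F^k(z, w) = (z^k, w^k)`, then each of the four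
ratios `z_i/z^k_i`, `z^k_i/z_i`, `w_i/w^k_i`, `w^k_i/w_i` is positive and at most
`4^((5^k − 1)/4)`. -/
theorem Fmap_iterate_ratio_bound_of_periodic (n k : ℕ) (hn : 1 ≤ n) (hk : 1 ≤ k)
    (x y : ZMod n → ℝ) (hper : (pentagramAutomaton n)^[k] (x, y) = (x, y))
    (t : ℝ) (ht : 1 < t) (z w : ZMod n → ℝ)
    (hz : ∀ i, z i = t ^ x i) (hw : ∀ i, w i = t ^ y i)
    (zk wk : ZMod n → ℝ) (hzk : zk = ((Fmap n)^[k] (z, w)).1)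
    (hwk : wk = ((Fmap n)^[k] (z, w)).2) :
    ∀ i : ZMod n,
      (0 < z i / zk i ∧ z i / zk i ≤ (4 : ℝ) ^ (((5 : ℝ) ^ k - 1) / 4)) ∧
      (0 < zk i / z i ∧ zk i / z i ≤ (4 : ℝ) ^ (((5 : ℝ) ^ k - 1) / 4)) ∧
      (0 < w i / wk i ∧ w i / wk i ≤ (4 : ℝ) ^ (((5 : ℝ) ^ k - 1) / 4)) ∧
      (0 < wk i / w i ∧ wk i / w i ≤ (4 : ℝ) ^ (((5 : ℝ) ^ k - 1) / 4)) := by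
  have ht0 : 0 < t := one_pos.trans ht
  have hz0 i : 0 < z i := hz i ▸ Real.rpow_pos_of_pos ht0 _
  have hw0 i : 0 < w i := hw i ▸ Real.rpow_pos_of_pos ht0 _
  have hlz i : Real.log (z i) = Real.log t * x i := by rw [hz, Real.log_rpow ht0, mul_comm]
  have hlw i : Real.log (w i) = Real.log t * y i := by rw [hw, Real.log_rpow ht0, mul_comm]
  intro i
  have key := Fmap_iterate_log_sub_pentagramAutomaton_iterate n (Real.log_pos ht).le (z, w) (x, y)
    (fun j => ⟨hz0 j, hw0 j⟩) (fun j => ⟨hlz j, hlw j⟩) k i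
  rw [hper, ← hzk, ← hwk, ← hlz, ← hlw] at key
  obtain ⟨⟨h1, h2⟩, h3, h4⟩ := key
  have hE : ((5 : ℝ) ^ k - 1) / 4 * Real.log 2 ≤ ((5 : ℝ) ^ k - 1) / 4 * Real.log 4 := by
    have : (1 : ℝ) ≤ 5 ^ k := one_le_pow₀ (by norm_num)
    exact mul_le_mul_of_nonneg_left (Real.log_le_log two_pos (by norm_num)) (by linarith)
  obtain ⟨a, b⟩ := div_le_rpow_of_abs_log_sub_le (hz0 i) h1 four_pos (h2.trans hE)
  obtain ⟨c, d⟩ := div_le_rpow_of_abs_log_sub_le (hw0 i) h3 four_pos (h4.trans hE)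
  exact ⟨a, b, c, d⟩
end

section
/- Let n, k ≥ 1 and let (x, y) ∈ (ZMod n → ℝ)² satisfy φ^k(x, y) = (x, y). Let t > 1 and take as initial value either (z_i, w_i) = (t^{x_i}, −t^{y_i}) for all i, or (z_i, w_i) = (−t^{x_i}, t^{y_i}) for all i. Then all iterates T^m(z, w) for 0 ≤ m ≤ k are defined (no denominator 1 − z_i w_i along the orbit vanishes), and writing T^k(z, w) = (z^k, w^k), the uniform estimates 0 < |z_i/z^k_i| ≤ 4^{(5^k − 1)/4}, 0 < |z^k_i/z_i| ≤ 4^{(5^k − 1)/4}, 0 < |w_i/w^k_i| ≤ 4^{(5^k − 1)/4}, and 0 < |w^k_i/w_i| ≤ 4^{(5^k − 1)/4} hold for every i ∈ ZMod n. -/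
/-- The pentagram map `T` in canonical coordinates (as a total map, using the convention
`a / 0 = 0`; definedness is expressed by nonvanishing of the denominators `1 − z_i w_i`). -/
noncomputable def Tmap (n : ℕ) (p : (ZMod n → ℝ) × (ZMod n → ℝ)) :
    (ZMod n → ℝ) × (ZMod n → ℝ) :=
  (fun i => p.1 i * (1 - p.1 (i - 1) * p.2 (i - 1)) / (1 - p.1 (i + 1) * p.2 (i + 1)),
   fun i => p.2 (i + 1) * (1 - p.1 (i + 2) * p.2 (i + 2)) / (1 - p.1 i * p.2 i))

/-- Two positive reals agree up to a factor `R`. -/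
def CloseUpTo (R a X : ℝ) : Prop := 0 < a ∧ 0 < X ∧ a ≤ R * X ∧ X ≤ R * a

/-- Replacing `1 + a b` by `t ^ max 0 (x + y)` costs at most a factor `2 R ^ 2` above and
`R ^ 2` below. -/
lemma one_add_mul_bounds {R a b t x y : ℝ} (hR : 1 ≤ R) (ht : 1 < t)
    (ha : CloseUpTo R a (t ^ x)) (hb : CloseUpTo R b (t ^ y)) :
    1 + a * b ≤ 2 * R ^ 2 * t ^ max 0 (x + y) ∧ t ^ max 0 (x + y) ≤ R ^ 2 * (1 + a * b) := by
  have ht0 : 0 < t := by linarith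
  obtain ⟨ha0, hX0, ha1, ha2⟩ := ha
  obtain ⟨hb0, hY0, hb1, hb2⟩ := hb
  have hab : 0 < a * b := mul_pos ha0 hb0
  have hR2 : 1 ≤ R ^ 2 := one_le_pow₀ hR
  have hup : a * b ≤ R ^ 2 * t ^ (x + y) := by
    rw [Real.rpow_add ht0]
    calc a * b ≤ (R * t ^ x) * (R * t ^ y) := by gcongr
      _ = _ := by ring
  have hlow : t ^ (x + y) ≤ R ^ 2 * (a * b) := by
    rw [Real.rpow_add ht0]
    calc t ^ x * t ^ y ≤ (R * a) * (R * b) := by gcongr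
      _ = _ := by ring
  have h1 : 1 ≤ t ^ max 0 (x + y) := Real.one_le_rpow ht.le (le_max_left _ _)
  have h2 : t ^ (x + y) ≤ t ^ max 0 (x + y) :=
    Real.rpow_le_rpow_of_exponent_le ht.le (le_max_right _ _)
  constructor
  · nlinarith [mul_le_mul_of_nonneg_left h2 (by positivity : 0 ≤ R ^ 2),
      mul_le_mul hR2 h1 zero_le_one (by positivity)]
  · rcases max_cases 0 (x + y) with ⟨h, _⟩ | ⟨h, _⟩
    · rw [h, Real.rpow_zero]
      nlinarith
    · rw [h]
      nlinarith

lemma CloseUpTo.mul_div {R a X D₁ D₂ M₁ M₂ : ℝ} (hR : 1 ≤ R) (ha : CloseUpTo R a X)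
    (hD₁ : 0 < D₁) (hD₂ : 0 < D₂) (hM₁ : 0 < M₁) (hM₂ : 0 < M₂)
    (h₁ : D₁ ≤ 2 * R ^ 2 * M₁ ∧ M₁ ≤ R ^ 2 * D₁) (h₂ : D₂ ≤ 2 * R ^ 2 * M₂ ∧ M₂ ≤ R ^ 2 * D₂) :
    CloseUpTo (2 * R ^ 5) (a * D₁ / D₂) (X * M₁ / M₂) := by
  obtain ⟨ha0, hX0, ha1, ha2⟩ := ha
  have hR0 : 0 < R := by linarith
  refine ⟨by positivity, by positivity, ?_, ?_⟩
  · rw [mul_div_assoc', div_le_div_iff₀ hD₂ hM₂]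
    calc a * D₁ * M₂ ≤ (R * X) * (2 * R ^ 2 * M₁) * (R ^ 2 * D₂) := by
          gcongr
          exacts [h₁.1, h₂.2]
      _ = _ := by ring
  · rw [mul_div_assoc', div_le_div_iff₀ hM₂ hD₂]
    calc X * M₁ * D₂ ≤ (R * a) * (R ^ 2 * D₁) * (2 * R ^ 2 * M₂) := by
          gcongr
          exacts [h₁.2, h₂.1]
      _ = _ := by ring

lemma CloseUpTo.step {R t a x a₁ b₁ x₁ y₁ a₂ b₂ x₂ y₂ : ℝ} (hR : 1 ≤ R) (ht : 1 < t)
    (h : CloseUpTo R a (t ^ x))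
    (ha₁ : CloseUpTo R a₁ (t ^ x₁)) (hb₁ : CloseUpTo R b₁ (t ^ y₁))
    (ha₂ : CloseUpTo R a₂ (t ^ x₂)) (hb₂ : CloseUpTo R b₂ (t ^ y₂)) :
    CloseUpTo (2 * R ^ 5) (a * (1 + a₁ * b₁) / (1 + a₂ * b₂))
      (t ^ (x + max 0 (x₁ + y₁) - max 0 (x₂ + y₂))) := by
  have ht0 : 0 < t := by linarith
  have := ha₁.1
  have := hb₁.1
  have := ha₂.1
  have := hb₂.1
  rw [Real.rpow_sub ht0, Real.rpow_add ht0]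
  exact h.mul_div hR (by positivity) (by positivity) (by positivity) (by positivity)
    (one_add_mul_bounds hR ht ha₁ hb₁) (one_add_mul_bounds hR ht ha₂ hb₂)

/-- `p = (z, w)` tracks `q = (x, y)` up to a factor `R`: `ε z` is comparable to `t ^ x` and
`-ε w` to `t ^ y`. -/
def Tracks {n : ℕ} (ε t R : ℝ) (p q : (ZMod n → ℝ) × (ZMod n → ℝ)) : Prop :=
  ∀ i, CloseUpTo R (ε * p.1 i) (t ^ q.1 i) ∧ CloseUpTo R (-ε * p.2 i) (t ^ q.2 i)

lemma one_sub_mul_eq {n : ℕ} {ε : ℝ} {p : (ZMod n → ℝ) × (ZMod n → ℝ)}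
    (hε : ε * ε = 1) (i : ZMod n) :
    1 - p.1 i * p.2 i = 1 + (ε * p.1 i) * (-ε * p.2 i) := by
  linear_combination p.1 i * p.2 i * hε

lemma Tracks.one_sub_ne_zero {n : ℕ} {ε t R : ℝ} {p q : (ZMod n → ℝ) × (ZMod n → ℝ)}
    (hε : ε * ε = 1) (h : Tracks ε t R p q) (i : ZMod n) : 1 - p.1 i * p.2 i ≠ 0 := by
  rw [one_sub_mul_eq hε]
  have := mul_pos (h i).1.1 (h i).2.1
  linarith

lemma Tracks.map {n : ℕ} {ε t R : ℝ} {p q : (ZMod n → ℝ) × (ZMod n → ℝ)}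
    (hε : ε * ε = 1) (hR : 1 ≤ R) (ht : 1 < t) (h : Tracks ε t R p q) :
    Tracks ε t (2 * R ^ 5) (Tmap n p) (pentagramAutomaton n q) := by
  intro i
  constructor
  · have := (h i).1.step hR ht (h (i - 1)).1 (h (i - 1)).2 (h (i + 1)).1 (h (i + 1)).2
    simpa only [Tmap, pentagramAutomaton, one_sub_mul_eq hε, mul_div_assoc, mul_assoc] using this
  · have := (h (i + 1)).2.step hR ht (h (i + 2)).1 (h (i + 2)).2 (h i).1 (h i).2
    simpa only [Tmap, pentagramAutomaton, one_sub_mul_eq hε, mul_div_assoc, mul_assoc] using this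

lemma Tracks.iterate {n : ℕ} {ε t : ℝ} {p q : (ZMod n → ℝ) × (ZMod n → ℝ)}
    (hε : ε * ε = 1) (ht : 1 < t) (h : Tracks ε t 1 p q) (m : ℕ) :
    Tracks ε t ((2 : ℝ) ^ (((5 : ℝ) ^ m - 1) / 4)) ((Tmap n)^[m] p)
      ((pentagramAutomaton n)^[m] q) := by
  induction m with
  | zero => simpa using h
  | succ m ih =>
    have h5 : (1 : ℝ) ≤ 5 ^ m := one_le_pow₀ (by norm_num)
    have hR : (1 : ℝ) ≤ 2 ^ (((5 : ℝ) ^ m - 1) / 4) :=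
      Real.one_le_rpow (by norm_num) (by linarith)
    have hstep : (2 : ℝ) ^ (((5 : ℝ) ^ (m + 1) - 1) / 4)
        = 2 * ((2 : ℝ) ^ (((5 : ℝ) ^ m - 1) / 4)) ^ 5 := by
      rw [← Real.rpow_mul_natCast (by norm_num),
        ← Real.rpow_one_add' (by norm_num) (by push_cast; linarith)]
      congr 1
      push_cast
      ring
    rw [Function.iterate_succ_apply', Function.iterate_succ_apply', hstep]
    exact ih.map hε hR ht

lemma CloseUpTo.abs_ratio_bounds {R S a b X : ℝ} (hRS : R ≤ S) (hb : CloseUpTo R |b| X)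
    (ha : |a| = X) :
    (0 < |a / b| ∧ |a / b| ≤ S) ∧ (0 < |b / a| ∧ |b / a| ≤ S) := by
  obtain ⟨hb0, hX0, h1, h2⟩ := hb
  subst ha
  rw [abs_div, abs_div, div_le_iff₀ hb0, div_le_iff₀ hX0]
  exact ⟨⟨by positivity, h2.trans (by gcongr)⟩, ⟨by positivity, h1.trans (by gcongr)⟩⟩


/-- Quasi-periodicity of the pentagram map: starting from a quasi-periodic initial value
obtained from a `k`-periodic point `(x, y)` of the pentagram automaton via
`(z, w) = (t^x, −t^y)` or `(−t^x, t^y)`, all iterates `T^m(z,w)`, `0 ≤ m ≤ k`, are defined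
(no denominator along the orbit vanishes) and the four ratio estimates
`0 < |z_i / z^k_i| ≤ 4^((5^k − 1)/4)` etc. hold, where `T^k(z, w) = (z^k, w^k)`. -/
theorem pentagram_quasi_periodicity (n k : ℕ) (hn : 1 ≤ n) (hk : 1 ≤ k)
    (x y : ZMod n → ℝ) (hper : (pentagramAutomaton n)^[k] (x, y) = (x, y))
    (t : ℝ) (ht : 1 < t) (z w : ZMod n → ℝ)
    (hzw : (∀ i, z i = t ^ x i ∧ w i = -(t ^ y i)) ∨
           (∀ i, z i = -(t ^ x i) ∧ w i = t ^ y i)) :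
    (∀ m < k, ∀ i : ZMod n,
        (1 : ℝ) - ((Tmap n)^[m] (z, w)).1 i * ((Tmap n)^[m] (z, w)).2 i ≠ 0) ∧
    (∀ i : ZMod n,
      (0 < |z i / ((Tmap n)^[k] (z, w)).1 i| ∧
        |z i / ((Tmap n)^[k] (z, w)).1 i| ≤ (4 : ℝ) ^ (((5 : ℝ) ^ k - 1) / 4)) ∧
      (0 < |((Tmap n)^[k] (z, w)).1 i / z i| ∧
        |((Tmap n)^[k] (z, w)).1 i / z i| ≤ (4 : ℝ) ^ (((5 : ℝ) ^ k - 1) / 4)) ∧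
      (0 < |w i / ((Tmap n)^[k] (z, w)).2 i| ∧
        |w i / ((Tmap n)^[k] (z, w)).2 i| ≤ (4 : ℝ) ^ (((5 : ℝ) ^ k - 1) / 4)) ∧
      (0 < |((Tmap n)^[k] (z, w)).2 i / w i| ∧
        |((Tmap n)^[k] (z, w)).2 i / w i| ≤ (4 : ℝ) ^ (((5 : ℝ) ^ k - 1) / 4))) := by
  obtain ⟨ε, hε, hz, hw⟩ : ∃ ε : ℝ, ε * ε = 1 ∧ (∀ i, ε * z i = t ^ x i) ∧
      ∀ i, -ε * w i = t ^ y i := by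
    rcases hzw with h | h
    · exact ⟨1, by norm_num, fun i => by simp [h i], fun i => by simp [h i]⟩
    · exact ⟨-1, by norm_num, fun i => by simp [h i], fun i => by simp [h i]⟩
  have ht0 : 0 < t := by linarith
  have habs : |ε| = 1 := by
    rcases mul_self_eq_one_iff.mp hε with rfl | rfl <;> simp
  have htrack : Tracks ε t 1 (z, w) (x, y) := fun i => by
    have := Real.rpow_pos_of_pos ht0 (x i)
    have := Real.rpow_pos_of_pos ht0 (y i)
    simp_all [CloseUpTo]
  refine ⟨fun m _ i => (htrack.iterate hε ht m).one_sub_ne_zero hε i, fun i => ?_⟩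
  have hclose := htrack.iterate hε ht k i
  rw [hper] at hclose
  have h5 : (1 : ℝ) ≤ 5 ^ k := one_le_pow₀ (by norm_num)
  have hRS : (2 : ℝ) ^ (((5 : ℝ) ^ k - 1) / 4) ≤ 4 ^ (((5 : ℝ) ^ k - 1) / 4) :=
    Real.rpow_le_rpow (by norm_num) (by norm_num) (by linarith)
  have abs_eq : ∀ {u v : ℝ}, 0 < v → ε * u = v ∨ -ε * u = v → |u| = v := by
    rintro u v hv (h | h) <;>
      simpa [abs_mul, habs, abs_of_pos hv] using congrArg abs h
  obtain ⟨h1, h2⟩ := CloseUpTo.abs_ratio_bounds hRS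
    (by rw [abs_eq hclose.1.1 (Or.inl rfl)]; exact hclose.1)
    (abs_eq hclose.1.2.1 (Or.inl (hz i)))
  obtain ⟨h3, h4⟩ := CloseUpTo.abs_ratio_bounds hRS
    (by rw [abs_eq hclose.2.1 (Or.inr rfl)]; exact hclose.2)
    (abs_eq hclose.2.2.1 (Or.inr (hw i)))
  exact ⟨h1, h2, h3, h4⟩
end

section
/- For every pair (z, w) of tuples of positive reals indexed by ZMod n, writing F(z, w) = (z', w'), one has Π_{i ∈ ZMod n} z'_i = Π_{i ∈ ZMod n} z_i and Π_{i ∈ ZMod n} w'_i = Π_{i ∈ ZMod n} w_i; that is, the quantities O_n = Π_i z_i and E_n = Π_i w_i are conserved by F. -/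
/-- The quantities `O_n = Π_i z_i` and `E_n = Π_i w_i` are conserved by `F`. -/
theorem Fmap_conserves_products (n : ℕ) [NeZero n] (z w : ZMod n → ℝ)
    (hz : ∀ i, 0 < z i) (hw : ∀ i, 0 < w i) :
    (∏ i : ZMod n, (Fmap n (z, w)).1 i) = (∏ i : ZMod n, z i) ∧
    (∏ i : ZMod n, (Fmap n (z, w)).2 i) = (∏ i : ZMod n, w i) := by
  have hpos : ∀ i, 0 < 1 + z i * w i := fun i => by
    have := mul_pos (hz i) (hw i)
    positivity
  have hne : (∏ i : ZMod n, (1 + z i * w i)) ≠ 0 :=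
    Finset.prod_ne_zero_iff.mpr fun i _ => (hpos i).ne'
  have shift (f : ZMod n → ℝ) (a : ZMod n) : ∏ i, f (i + a) = ∏ i, f i :=
    Equiv.prod_comp (Equiv.addRight a) f
  have shift_sub (f : ZMod n → ℝ) (a : ZMod n) : ∏ i, f (i - a) = ∏ i, f i :=
    Equiv.prod_comp (Equiv.subRight a) f
  simp only [Fmap, Finset.prod_div_distrib]
  constructor
  · rw [Finset.prod_mul_distrib, shift_sub (fun i => 1 + z i * w i) 1,
      shift (fun i => 1 + z i * w i) 1, mul_div_cancel_right₀ _ hne]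
  · rw [Finset.prod_mul_distrib, shift (fun i => 1 + z i * w i) 2, shift w 1,
      mul_div_cancel_right₀ _ hne]
end
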